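/- arXiv:1410.0312 — 2 statements merged into one kernel-verified Lean document; each statement's English description precedes it below -/
import Mathlib

section
/- Let F be a field with char F ∉ {2,3,7} and let c ∈ F satisfy c^2 + c + 2 = 0. With P_1 = zD_3, P_2 = xD_1, P_3 = yD_2 and Q_1 = zC_2, Q_2 = xC_2, Q_3 = y((y^2−z^2)D_2 + C_3) as in the context, the F-vector space R_8 of homogeneous octics in R = F[x,y,z] decomposes as a direct sum R_8 = span_F{P_iQ_j : 1 ≤ i, j ≤ 3} ⊕ (P^2)_8, where (P^2)_8 denotes the degree-8 homogeneous component of the square of the ideal P = (P_1, P_2, P_3). -/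
open MvPolynomial

noncomputable section

/-- `C₃ = 4x⁴+4y⁴+(3c+9)x²y²+(5c−1)x²z²+(5c−1)y²z²+(15c+25)z⁴`. -/
def C₃ {F : Type*} [Field F] (c : F) : MvPolynomial (Fin 3) F :=
  4 * X 0 ^ 4 + 4 * X 1 ^ 4 + C (3 * c + 9) * X 0 ^ 2 * X 1 ^ 2 +
    C (5 * c - 1) * X 0 ^ 2 * X 2 ^ 2 + C (5 * c - 1) * X 1 ^ 2 * X 2 ^ 2 +
    C (15 * c + 25) * X 2 ^ 4

/-- `C₁ = (15c+25)x⁴+4y⁴+(5c−1)x²y²+(5c−1)x²z²+(3c+9)y²z²+4z⁴`. -/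
def C₁ {F : Type*} [Field F] (c : F) : MvPolynomial (Fin 3) F :=
  C (15 * c + 25) * X 0 ^ 4 + 4 * X 1 ^ 4 + C (5 * c - 1) * X 0 ^ 2 * X 1 ^ 2 +
    C (5 * c - 1) * X 0 ^ 2 * X 2 ^ 2 + C (3 * c + 9) * X 1 ^ 2 * X 2 ^ 2 +
    4 * X 2 ^ 4

/-- `C₂ = 4x⁴+(15c+25)y⁴+(5c−1)x²y²+(3c+9)x²z²+(5c−1)y²z²+4z⁴`. -/
def C₂ {F : Type*} [Field F] (c : F) : MvPolynomial (Fin 3) F :=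
  4 * X 0 ^ 4 + C (15 * c + 25) * X 1 ^ 4 + C (5 * c - 1) * X 0 ^ 2 * X 1 ^ 2 +
    C (3 * c + 9) * X 0 ^ 2 * X 2 ^ 2 + C (5 * c - 1) * X 1 ^ 2 * X 2 ^ 2 +
    4 * X 2 ^ 4

/-- `D₃ = (15c+21)x²+(15c+21)y²+(2c−10)z²`. -/
def D₃ {F : Type*} [Field F] (c : F) : MvPolynomial (Fin 3) F :=
  C (15 * c + 21) * X 0 ^ 2 + C (15 * c + 21) * X 1 ^ 2 + C (2 * c - 10) * X 2 ^ 2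

/-- `D₁ = (2c−10)x²+(15c+21)y²+(15c+21)z²`. -/
def D₁ {F : Type*} [Field F] (c : F) : MvPolynomial (Fin 3) F :=
  C (2 * c - 10) * X 0 ^ 2 + C (15 * c + 21) * X 1 ^ 2 + C (15 * c + 21) * X 2 ^ 2

/-- `D₂ = (15c+21)x²+(2c−10)y²+(15c+21)z²`. -/
def D₂ {F : Type*} [Field F] (c : F) : MvPolynomial (Fin 3) F :=
  C (15 * c + 21) * X 0 ^ 2 + C (2 * c - 10) * X 1 ^ 2 + C (15 * c + 21) * X 2 ^ 2

/-- `f = xy(x²−y²)C₃`. -/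
def kf {F : Type*} [Field F] (c : F) : MvPolynomial (Fin 3) F :=
  X 0 * X 1 * (X 0 ^ 2 - X 1 ^ 2) * C₃ c

/-- `g = yz(y²−z²)C₁`. -/
def kg {F : Type*} [Field F] (c : F) : MvPolynomial (Fin 3) F :=
  X 1 * X 2 * (X 1 ^ 2 - X 2 ^ 2) * C₁ c

/-- `h = zx(z²−x²)C₂`. -/
def kh {F : Type*} [Field F] (c : F) : MvPolynomial (Fin 3) F :=
  X 2 * X 0 * (X 2 ^ 2 - X 0 ^ 2) * C₂ c

/-- The degree-3 syzygy `(P₁,P₂,P₃) = (zD₃, xD₁, yD₂)`. -/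
def kP {F : Type*} [Field F] (c : F) : Fin 3 → MvPolynomial (Fin 3) F :=
  ![X 2 * D₃ c, X 0 * D₁ c, X 1 * D₂ c]

/-- The degree-5 syzygy `(Q₁,Q₂,Q₃) = (zC₂, xC₂, y((y²−z²)D₂ + C₃))`. -/
def kQ {F : Type*} [Field F] (c : F) : Fin 3 → MvPolynomial (Fin 3) F :=
  ![X 2 * C₂ c, X 0 * C₂ c, X 1 * ((X 1 ^ 2 - X 2 ^ 2) * D₂ c + C₃ c)]

/-- If `f` lies in the ideal generated by forms `G i` of degree `d` and is homogeneous of degree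
`e + d`, then it is a combination of the `G i` whose coefficients are forms of degree `e`. -/
lemma exists_isHomogeneous_eq_sum_mul {σ ι K : Type*} [CommRing K] [Fintype ι]
    {G : ι → MvPolynomial σ K} {d e : ℕ} (hG : ∀ i, (G i).IsHomogeneous d)
    {f : MvPolynomial σ K} (hf : f ∈ Ideal.span (Set.range G)) (hfd : f.IsHomogeneous (e + d)) :
    ∃ a : ι → MvPolynomial σ K, (∀ i, (a i).IsHomogeneous e) ∧ f = ∑ i, a i * G i := by
  obtain ⟨a, rfl⟩ := Ideal.mem_span_range_iff_exists_fun.1 hf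
  refine ⟨fun i => homogeneousComponent e (a i),
    fun i => homogeneousComponent_isHomogeneous e (a i), ?_⟩
  rw [← homogeneousComponent_eq_self hfd, map_sum]
  refine Finset.sum_congr rfl fun i _ => ?_
  let _ : GradedAlgebra (homogeneousSubmodule σ K) := MvPolynomial.gradedAlgebra
  have h := DirectSum.coe_decompose_mul_add_of_right_mem (homogeneousSubmodule σ K)
    (a := a i) (i := e) (hG i)
  beta_reduce
  rwa [← decomposition.decompose'_apply, ← decomposition.decompose'_apply]

/-- A subspace containing all monomials of degree `n` contains all forms of degree `n`. -/
lemma homogeneousSubmodule_le_of_monomials {K : Type*} [CommRing K] {n : ℕ}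
    {M : Submodule K (MvPolynomial (Fin 3) K)}
    (h : ∀ i j k : ℕ, i + j + k = n → X 0 ^ i * X 1 ^ j * X 2 ^ k ∈ M) :
    homogeneousSubmodule (Fin 3) K n ≤ M := by
  intro f hf
  rw [f.as_sum]
  refine M.sum_mem fun v hv => ?_
  have hdeg : v.degree = n := by
    by_contra hne
    exact mem_support_iff.1 hv (IsHomogeneous.coeff_eq_zero hf hne)
  rw [Finsupp.degree_eq_sum, Fin.sum_univ_three] at hdeg
  have := M.smul_mem (coeff v f) (h _ _ _ hdeg)
  rwa [smul_eq_C_mul, ← Fin.prod_univ_three fun i => (X i : MvPolynomial (Fin 3) K) ^ v i,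
    ← Finsupp.prod_fintype v (fun i m => (X i : MvPolynomial (Fin 3) K) ^ m) (by simp),
    ← monomial_eq] at this

lemma finrank_homogeneousSubmodule {σ K : Type*} [Fintype σ] [DecidableEq σ] [Field K] (n : ℕ) :
    Module.finrank K (homogeneousSubmodule σ K n) = (Fintype.card σ).multichoose n := by
  have hs : {d : σ →₀ ℕ | d.degree = n} = ((Finset.univ : Finset σ).finsuppAntidiag n : Set _) := by
    ext d
    simp [Finsupp.degree_eq_sum]
  rw [homogeneousSubmodule_eq_finsupp_supported, hs,
    (AddMonoidAlgebra.supportedEquivFinsupp _).finrank_eq, Module.finrank_finsupp_self]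
  simp [Finset.card_finsuppAntidiag_nat_eq_multichoose]

/-- The cubics `x (t x² + s y² + s z²)` and its two companions lie in the ideal `I`. -/
structure ContainsKleinCubics {F A : Type*} [Field F] [CommRing A] [Algebra F A]
    (I : Ideal A) (s t : F) (x y z : A) : Prop where
  fst : x * (t • x ^ 2 + s • y ^ 2 + s • z ^ 2) ∈ I
  snd : y * (s • x ^ 2 + t • y ^ 2 + s • z ^ 2) ∈ I
  trd : z * (s • x ^ 2 + s • y ^ 2 + t • z ^ 2) ∈ I

/-- The parameters for which the three cubics form a complete intersection. -/
structure KleinNondegenerate {F : Type*} [Field F] (s t : F) : Prop where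
  ne_zero : t ≠ 0
  sub_ne_zero : t - s ≠ 0
  add_ne_zero : t + s ≠ 0
  add_two_mul_ne_zero : t + 2 * s ≠ 0

namespace ContainsKleinCubics

variable {F A : Type*} [Field F] [CommRing A] [Algebra F A] {I : Ideal A} {s t : F} {x y z : A}

lemma rotate (h : ContainsKleinCubics I s t x y z) : ContainsKleinCubics I s t y z x where
  fst := by convert h.snd using 1; ring
  snd := by convert h.trd using 1; ring
  trd := by convert h.fst using 1; ring

lemma swap (h : ContainsKleinCubics I s t x y z) : ContainsKleinCubics I s t y x z where
  fst := by convert h.snd using 1; ring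
  snd := by convert h.fst using 1; ring
  trd := by convert h.trd using 1; ring

lemma mem_of_smul_mem {a : F} (ha : a ≠ 0) {p : A} (h : a • p ∈ I) : p ∈ I :=
  ((I.restrictScalars F).smul_mem_iff ha).1 h

lemma cube_mul_mul_mem (h : ContainsKleinCubics I s t x y z) (hst : KleinNondegenerate s t) :
    x ^ 3 * y * z ∈ I := by
  refine mem_of_smul_mem (mul_ne_zero hst.sub_ne_zero hst.add_two_mul_ne_zero) ?_
  convert I.sub_mem (I.sub_mem (I.mul_mem_left (algebraMap F A (t + s) * (y * z)) h.fst)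
    (I.mul_mem_left (algebraMap F A s * (x * z)) h.snd))
    (I.mul_mem_left (algebraMap F A s * (x * y)) h.trd) using 1
  simp only [Algebra.smul_def, map_add, map_sub, map_mul, map_ofNat]
  ring

lemma smul_cube_mul_add_mem (h : ContainsKleinCubics I s t x y z)
    (hst : KleinNondegenerate s t) : (t + s) • (x ^ 3 * y) + s • (x * y * z ^ 2) ∈ I := by
  refine mem_of_smul_mem hst.sub_ne_zero ?_
  convert I.sub_mem (I.mul_mem_left (algebraMap F A t * y) h.fst)
    (I.mul_mem_left (algebraMap F A s * x) h.snd) using 1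
  simp only [Algebra.smul_def, map_add, map_sub]
  ring

lemma pow_mul_pow_mul_pow_mem (h : ContainsKleinCubics I s t x y z)
    (hst : KleinNondegenerate s t) {i j k : ℕ} (hi : i ≠ 0) (hj : j ≠ 0) (hk : k ≠ 0)
    (hijk : 7 ≤ i + j + k) : x ^ i * y ^ j * z ^ k ∈ I := by
  obtain ⟨i, rfl⟩ := Nat.exists_eq_add_one_of_ne_zero hi
  obtain ⟨j, rfl⟩ := Nat.exists_eq_add_one_of_ne_zero hj
  obtain ⟨k, rfl⟩ := Nat.exists_eq_add_one_of_ne_zero hk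
  have hcases : 2 ≤ i ∨ 2 ≤ j ∨ 2 ≤ k := by omega
  rcases hcases with hi | hj | hk
  · obtain ⟨i, rfl⟩ := Nat.exists_eq_add_of_le hi
    convert I.mul_mem_left (x ^ i * y ^ j * z ^ k) (h.cube_mul_mul_mem hst) using 1
    ring
  · obtain ⟨j, rfl⟩ := Nat.exists_eq_add_of_le hj
    convert I.mul_mem_left (x ^ i * y ^ j * z ^ k) (h.rotate.cube_mul_mul_mem hst) using 1
    ring
  · obtain ⟨k, rfl⟩ := Nat.exists_eq_add_of_le hk
    convert I.mul_mem_left (x ^ i * y ^ j * z ^ k) (h.rotate.rotate.cube_mul_mul_mem hst) using 1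
    ring

lemma pow_mul_pow_mem_of_three_le (h : ContainsKleinCubics I s t x y z)
    (hst : KleinNondegenerate s t) {i j : ℕ} (hi : 3 ≤ i) (hj : j ≠ 0) (hij : 7 ≤ i + j) :
    x ^ i * y ^ j ∈ I := by
  obtain ⟨i, rfl⟩ := Nat.exists_eq_add_of_le hi
  have hmem : x ^ (i + 1) * y ^ j * z ^ 2 ∈ I :=
    h.pow_mul_pow_mul_pow_mem hst (by omega) hj two_ne_zero (by omega)
  obtain ⟨j, rfl⟩ := Nat.exists_eq_add_one_of_ne_zero hj
  refine mem_of_smul_mem hst.add_ne_zero ?_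
  convert I.sub_mem (I.mul_mem_left (x ^ i * y ^ j) (h.smul_cube_mul_add_mem hst))
    (I.mul_mem_left (algebraMap F A s) hmem) using 1
  simp only [Algebra.smul_def]
  ring

lemma pow_mul_pow_mem (h : ContainsKleinCubics I s t x y z)
    (hst : KleinNondegenerate s t) {i j : ℕ} (hi : i ≠ 0) (hj : j ≠ 0) (hij : 7 ≤ i + j) :
    x ^ i * y ^ j ∈ I := by
  rcases le_or_gt 3 i with h3 | h3
  · exact h.pow_mul_pow_mem_of_three_le hst h3 hj hij
  · rw [mul_comm]
    exact h.swap.pow_mul_pow_mem_of_three_le hst (by omega) hi (by omega)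

lemma pow_mem (h : ContainsKleinCubics I s t x y z) (hst : KleinNondegenerate s t) {i : ℕ}
    (hi : 7 ≤ i) : x ^ i ∈ I := by
  obtain ⟨i, rfl⟩ := Nat.exists_eq_add_of_le hi
  have hy : x ^ (i + 5) * y ^ 2 ∈ I :=
    h.pow_mul_pow_mem hst (by omega) two_ne_zero (by omega)
  have hz : z ^ 2 * x ^ (i + 5) ∈ I :=
    h.rotate.rotate.pow_mul_pow_mem hst two_ne_zero (by omega) (by omega)
  refine mem_of_smul_mem hst.ne_zero ?_
  convert I.sub_mem (I.sub_mem (I.mul_mem_left (x ^ (i + 4)) h.fst)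
    (I.mul_mem_left (algebraMap F A s) hy)) (I.mul_mem_left (algebraMap F A s) hz) using 1
  simp only [Algebra.smul_def]
  ring

/-- The ideal contains all monomials of degree at least seven. -/
lemma monomial_mem (h : ContainsKleinCubics I s t x y z) (hst : KleinNondegenerate s t)
    {i j k : ℕ} (hijk : 7 ≤ i + j + k) : x ^ i * y ^ j * z ^ k ∈ I := by
  rcases eq_or_ne i 0 with rfl | hi <;> rcases eq_or_ne j 0 with rfl | hj <;>
    rcases eq_or_ne k 0 with rfl | hk
  · omega
  · simpa using h.rotate.rotate.pow_mem hst (by omega)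
  · simpa using h.rotate.pow_mem hst (by omega)
  · simpa using h.rotate.pow_mul_pow_mem hst hj hk (by omega)
  · simpa using h.pow_mem hst (by omega)
  · simpa [mul_comm] using h.rotate.rotate.pow_mul_pow_mem hst hk hi (by omega)
  · simpa using h.pow_mul_pow_mem hst hi hj (by omega)
  · exact h.pow_mul_pow_mul_pow_mem hst hi hj hk hijk

lemma smul_cube_mul_sq_add_mem (h : ContainsKleinCubics I s t x y z)
    (hst : KleinNondegenerate s t) :
    (t + s) • (x ^ 3 * y ^ 2) + s • (x * y ^ 2 * z ^ 2) ∈ I := by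
  convert I.mul_mem_left y (h.smul_cube_mul_add_mem hst) using 1
  simp only [Algebra.smul_def]
  ring

lemma smul_mul_pow_four_add_mem (h : ContainsKleinCubics I s t x y z)
    (hst : KleinNondegenerate s t) :
    (t + s) • (x * y ^ 4) + s • (x * y ^ 2 * z ^ 2) ∈ I := by
  convert I.mul_mem_left y (h.swap.smul_cube_mul_add_mem hst) using 1
  simp only [Algebra.smul_def]
  ring

lemma smul_pow_five_sub_mem (h : ContainsKleinCubics I s t x y z)
    (hst : KleinNondegenerate s t) :
    (t * (t + s)) • x ^ 5 - (2 * s ^ 2) • (x * y ^ 2 * z ^ 2) ∈ I := by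
  convert I.sub_mem (I.sub_mem (I.mul_mem_left (algebraMap F A (t + s) * x ^ 2) h.fst)
    (I.mul_mem_left (algebraMap F A s) (h.smul_cube_mul_sq_add_mem hst)))
    (I.mul_mem_left (algebraMap F A s) (h.rotate.rotate.swap.smul_cube_mul_sq_add_mem hst)) using 1
  simp only [Algebra.smul_def, map_add, map_mul, map_pow, map_ofNat]
  ring

/-- A quintic combination of the monomials `x m` with `m` even, reduced modulo the ideal to a
multiple of `x y² z²`. -/
lemma smul_quintic_sub_mem (h : ContainsKleinCubics I s t x y z) (hst : KleinNondegenerate s t)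
    (a b₁ b₂ d₁ d₂ e : F) :
    (t * (t + s)) • (x * (a • x ^ 4 + b₁ • y ^ 4 + b₂ • z ^ 4 + d₁ • (x ^ 2 * y ^ 2) +
      d₂ • (x ^ 2 * z ^ 2) + e • (y ^ 2 * z ^ 2))) -
      (2 * s ^ 2 * a - s * t * (b₁ + b₂ + d₁ + d₂) + t * (t + s) * e) •
        (x * y ^ 2 * z ^ 2) ∈ I := by
  have h' := h.rotate.rotate.swap
  convert I.add_mem (I.mul_mem_left (algebraMap F A a) (h.smul_pow_five_sub_mem hst))
    (I.add_mem (I.add_mem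
      (I.mul_mem_left (algebraMap F A (t * b₁)) (h.smul_mul_pow_four_add_mem hst))
      (I.mul_mem_left (algebraMap F A (t * b₂)) (h'.smul_mul_pow_four_add_mem hst)))
    (I.add_mem
      (I.mul_mem_left (algebraMap F A (t * d₁)) (h.smul_cube_mul_sq_add_mem hst))
      (I.mul_mem_left (algebraMap F A (t * d₂)) (h'.smul_cube_mul_sq_add_mem hst)))) using 1
  simp only [Algebra.smul_def, map_add, map_sub, map_mul, map_pow, map_ofNat]
  ring

section Quintics

variable {M : Submodule F A}

lemma mem_of_smul_add_mem (hI : I.restrictScalars F ≤ M) {a b : F} (ha : a ≠ 0) {p q : A}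
    (h : a • p + b • q ∈ I) (hq : q ∈ M) : p ∈ M := by
  refine (M.smul_mem_iff ha).1 ?_
  simpa using M.sub_mem (hI h) (M.smul_mem b hq)

lemma odd_quintics_mem (h : ContainsKleinCubics I s t x y z) (hst : KleinNondegenerate s t)
    (hI : I.restrictScalars F ≤ M) (hM : x * y ^ 2 * z ^ 2 ∈ M) :
    x ^ 5 ∈ M ∧ x ^ 3 * y ^ 2 ∈ M ∧ x ^ 3 * z ^ 2 ∈ M ∧ x * y ^ 4 ∈ M ∧ x * z ^ 4 ∈ M := by
  have hM' : x * z ^ 2 * y ^ 2 ∈ M := by convert hM using 1; ring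
  have h' := h.rotate.rotate.swap
  refine ⟨mem_of_smul_add_mem hI (b := -(2 * s ^ 2)) (mul_ne_zero hst.ne_zero hst.add_ne_zero)
    ?_ hM,
    mem_of_smul_add_mem hI hst.add_ne_zero (h.smul_cube_mul_sq_add_mem hst) hM,
    mem_of_smul_add_mem hI hst.add_ne_zero (h'.smul_cube_mul_sq_add_mem hst) hM',
    mem_of_smul_add_mem hI hst.add_ne_zero (h.smul_mul_pow_four_add_mem hst) hM,
    mem_of_smul_add_mem hI hst.add_ne_zero (h'.smul_mul_pow_four_add_mem hst) hM'⟩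
  rw [neg_smul, ← sub_eq_add_neg]
  exact h.smul_pow_five_sub_mem hst

/-- Modulo the ideal, quintic monomials are spanned by `x y² z²`, `x² y z²` and `x² y² z`. -/
lemma quintic_monomial_mem (h : ContainsKleinCubics I s t x y z) (hst : KleinNondegenerate s t)
    (hI : I.restrictScalars F ≤ M) (hx : x * y ^ 2 * z ^ 2 ∈ M) (hy : y * z ^ 2 * x ^ 2 ∈ M)
    (hz : z * x ^ 2 * y ^ 2 ∈ M) {i j k : ℕ} (hijk : i + j + k = 5) :
    x ^ i * y ^ j * z ^ k ∈ M := by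
  have hx3 := hI (h.cube_mul_mul_mem hst)
  have hy3 := hI (h.rotate.cube_mul_mul_mem hst)
  have hz3 := hI (h.rotate.rotate.cube_mul_mul_mem hst)
  obtain ⟨hx₁, hx₂, hx₃, hx₄, hx₅⟩ := h.odd_quintics_mem hst hI hx
  obtain ⟨hy₁, hy₂, hy₃, hy₄, hy₅⟩ := h.rotate.odd_quintics_mem hst hI hy
  obtain ⟨hz₁, hz₂, hz₃, hz₄, hz₅⟩ := h.rotate.rotate.odd_quintics_mem hst hI hz
  obtain rfl : k = 5 - i - j := by omega
  have hi : i ≤ 5 := by omega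
  have hj : j ≤ 5 - i := by omega
  clear hijk
  interval_cases i <;> interval_cases j <;> ring_nf at * <;> assumption

end Quintics

end ContainsKleinCubics

section KleinSyzygies

variable {F : Type*} [Field F] {c : F}

/-- The ideal generated by the cubics `P₁`, `P₂`, `P₃`. -/
def kleinIdeal (c : F) : Ideal (MvPolynomial (Fin 3) F) := Ideal.span (Set.range (kP c))

lemma kP_mem (c : F) (i : Fin 3) : kP c i ∈ kleinIdeal c :=
  Ideal.subset_span (Set.mem_range_self i)

lemma containsKleinCubics (c : F) :
    ContainsKleinCubics (kleinIdeal c) (15 * c + 21) (2 * c - 10) (X 0) (X 1) (X 2) where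
  fst := by simpa [kP, D₁, smul_eq_C_mul] using kP_mem c 1
  snd := by simpa [kP, D₂, smul_eq_C_mul] using kP_mem c 2
  trd := by simpa [kP, D₃, smul_eq_C_mul] using kP_mem c 0

lemma linear_ne_zero_of_norm (hc : c ^ 2 + c + 2 = 0) {a b : F}
    (h : b ^ 2 - a * b + 2 * a ^ 2 ≠ 0) : a * c + b ≠ 0 := by
  intro h0
  apply h
  linear_combination (b - a - a * c) * h0 + a ^ 2 * hc

lemma kleinNondegenerate (hc : c ^ 2 + c + 2 = 0) (h2 : (2 : F) ≠ 0) (h7 : (7 : F) ≠ 0) :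
    KleinNondegenerate (15 * c + 21) (2 * c - 10) where
  ne_zero := by
    convert linear_ne_zero_of_norm hc (a := 2) (b := -10) ?_ using 1
    · ring
    · convert pow_ne_zero 7 h2 using 1
      norm_num
  sub_ne_zero := by
    convert linear_ne_zero_of_norm hc (a := -13) (b := -31) ?_ using 1
    · ring
    · convert mul_ne_zero (pow_ne_zero 7 h2) h7 using 1
      norm_num
  add_ne_zero := by
    convert linear_ne_zero_of_norm hc (a := 17) (b := 11) ?_ using 1
    · ring
    · convert pow_ne_zero 9 h2 using 1
      norm_num
  add_two_mul_ne_zero := by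
    convert linear_ne_zero_of_norm hc (a := 32) (b := 32) ?_ using 1
    · ring
    · convert pow_ne_zero 11 h2 using 1
      norm_num

lemma isHomogeneous_diagonal_quadric (a b d : F) :
    (C a * X 0 ^ 2 + C b * X 1 ^ 2 + C d * X 2 ^ 2 :
      MvPolynomial (Fin 3) F).IsHomogeneous 2 :=
  ((isHomogeneous_C_mul_X_pow a 0 2).add (isHomogeneous_C_mul_X_pow b 1 2)).add
    (isHomogeneous_C_mul_X_pow d 2 2)

lemma kP_isHomogeneous (c : F) (i : Fin 3) : (kP c i).IsHomogeneous 3 := by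
  fin_cases i
  · exact (isHomogeneous_X F 2).mul (isHomogeneous_diagonal_quadric _ _ _)
  · exact (isHomogeneous_X F 0).mul (isHomogeneous_diagonal_quadric _ _ _)
  · exact (isHomogeneous_X F 1).mul (isHomogeneous_diagonal_quadric _ _ _)

lemma isHomogeneous_C_mul_sq_mul_sq (a : F) (i j : Fin 3) :
    (C a * X i ^ 2 * X j ^ 2 : MvPolynomial (Fin 3) F).IsHomogeneous 4 :=
  (isHomogeneous_C_mul_X_pow a i 2).mul (isHomogeneous_X_pow j 2)

lemma isHomogeneous_four_mul_pow (i : Fin 3) :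
    (4 * X i ^ 4 : MvPolynomial (Fin 3) F).IsHomogeneous 4 := by
  simpa only [map_ofNat] using isHomogeneous_C_mul_X_pow (4 : F) i 4

lemma C₂_isHomogeneous (c : F) : (C₂ c).IsHomogeneous 4 :=
  (((((isHomogeneous_four_mul_pow 0).add (isHomogeneous_C_mul_X_pow _ 1 4)).add
    (isHomogeneous_C_mul_sq_mul_sq _ 0 1)).add (isHomogeneous_C_mul_sq_mul_sq _ 0 2)).add
    (isHomogeneous_C_mul_sq_mul_sq _ 1 2)).add (isHomogeneous_four_mul_pow 2)

lemma C₃_isHomogeneous (c : F) : (C₃ c).IsHomogeneous 4 :=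
  (((((isHomogeneous_four_mul_pow 0).add (isHomogeneous_four_mul_pow 1)).add
    (isHomogeneous_C_mul_sq_mul_sq _ 0 1)).add (isHomogeneous_C_mul_sq_mul_sq _ 0 2)).add
    (isHomogeneous_C_mul_sq_mul_sq _ 1 2)).add (isHomogeneous_C_mul_X_pow _ 2 4)

lemma kQ_isHomogeneous (c : F) (i : Fin 3) : (kQ c i).IsHomogeneous 5 := by
  fin_cases i
  · exact (isHomogeneous_X F 2).mul (C₂_isHomogeneous c)
  · exact (isHomogeneous_X F 0).mul (C₂_isHomogeneous c)
  · exact (isHomogeneous_X F 1).mul ((((isHomogeneous_X_pow 1 2).sub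
      (isHomogeneous_X_pow 2 2)).mul (isHomogeneous_diagonal_quadric _ _ _)).add
      (C₃_isHomogeneous c))

/-- A quintic congruent to a nonzero multiple of `m` modulo `I` spans `m` modulo `I`. -/
lemma mem_of_smul_sub_smul_mem {A : Type*} [CommRing A] [Algebra F A] {I : Ideal A}
    {M : Submodule F A} (hI : I.restrictScalars F ≤ M) {a b : F} (hb : b ≠ 0) {q m : A}
    (h : a • q - b • m ∈ I) (hq : q ∈ M) : m ∈ M := by
  refine (M.smul_mem_iff hb).1 ?_
  simpa using M.sub_mem (M.smul_mem a hq) (hI h)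

lemma quintic_le (hc : c ^ 2 + c + 2 = 0) (h2 : (2 : F) ≠ 0) (h7 : (7 : F) ≠ 0) :
    homogeneousSubmodule (Fin 3) F 5 ≤
      (kleinIdeal c).restrictScalars F ⊔ Submodule.span F (Set.range (kQ c)) := by
  have h := containsKleinCubics c
  have hst := kleinNondegenerate hc h2 h7
  set M := (kleinIdeal c).restrictScalars F ⊔ Submodule.span F (Set.range (kQ c))
  have hI : (kleinIdeal c).restrictScalars F ≤ M := le_sup_left
  have hQ (i : Fin 3) : kQ c i ∈ M :=
    le_sup_right (a := (kleinIdeal c).restrictScalars F)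
      (Submodule.subset_span (Set.mem_range_self i))
  have hne : (11584 : F) * c + 5568 ≠ 0 := by
    refine linear_ne_zero_of_norm hc ?_
    convert mul_ne_zero (pow_ne_zero 25 h2) h7 using 1
    norm_num
  have hx : X 0 * X 1 ^ 2 * X 2 ^ 2 ∈ M := by
    refine mem_of_smul_sub_smul_mem hI hne ?_ (hQ 1)
      (a := (2 * c - 10) * (2 * c - 10 + (15 * c + 21)))
    convert h.smul_quintic_sub_mem hst 4 (15 * c + 25) 4 (5 * c - 1) (3 * c + 9) (5 * c - 1)
      using 3
    · simp [kQ, C₂, smul_eq_C_mul, map_ofNat C]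
      ring
    · linear_combination (520 * c - 2920) * hc
  have hy : X 1 * X 2 ^ 2 * X 0 ^ 2 ∈ M := by
    have hQ' : X 1 * C₃ c ∈ M := by
      have h2' := (kleinIdeal c).mul_mem_left (X 1 ^ 2 - X 2 ^ 2) (kP_mem c 2)
      convert M.sub_mem (hQ 2) (hI h2') using 1
      simp [kQ, kP]
      ring
    refine mem_of_smul_sub_smul_mem hI hne ?_ hQ'
      (a := (2 * c - 10) * (2 * c - 10 + (15 * c + 21)))
    convert h.rotate.smul_quintic_sub_mem hst 4 (15 * c + 25) 4 (5 * c - 1) (3 * c + 9)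
      (5 * c - 1) using 3
    · simp [C₃, smul_eq_C_mul, map_ofNat C]
      ring
    · linear_combination (520 * c - 2920) * hc
  have hz : X 2 * X 0 ^ 2 * X 1 ^ 2 ∈ M := by
    refine mem_of_smul_sub_smul_mem hI hne ?_ (hQ 0)
      (a := (2 * c - 10) * (2 * c - 10 + (15 * c + 21)))
    convert h.rotate.rotate.smul_quintic_sub_mem hst 4 4 (15 * c + 25) (3 * c + 9) (5 * c - 1)
      (5 * c - 1) using 3
    · simp [kQ, C₂, smul_eq_C_mul, map_ofNat C]
      ring
    · linear_combination (520 * c - 2920) * hc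
  exact homogeneousSubmodule_le_of_monomials fun i j k hijk =>
    h.quintic_monomial_mem hst hI hx hy hz hijk

lemma octic_le (hc : c ^ 2 + c + 2 = 0) (h2 : (2 : F) ≠ 0) (h7 : (7 : F) ≠ 0) :
    homogeneousSubmodule (Fin 3) F 8 ≤ (kleinIdeal c).restrictScalars F :=
  homogeneousSubmodule_le_of_monomials fun _ _ _ hijk =>
    (containsKleinCubics c).monomial_mem (kleinNondegenerate hc h2 h7) (by omega)

/-- Every octic is a combination of the `Pᵢ Qⱼ` modulo the square of the ideal. -/
lemma octic_le_sup (hc : c ^ 2 + c + 2 = 0) (h2 : (2 : F) ≠ 0) (h7 : (7 : F) ≠ 0) :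
    homogeneousSubmodule (Fin 3) F 8 ≤
      Submodule.span F (Set.range fun p : Fin 3 × Fin 3 => kP c p.1 * kQ c p.2) ⊔
        (kleinIdeal c ^ 2).restrictScalars F := by
  intro f hf
  obtain ⟨a, ha, rfl⟩ := exists_isHomogeneous_eq_sum_mul (e := 5) (kP_isHomogeneous c)
    (octic_le hc h2 h7 hf) hf
  refine Submodule.sum_mem _ fun i _ => ?_
  obtain ⟨p, hp, q, hq, hpq⟩ := Submodule.mem_sup.1 (quintic_le hc h2 h7 (ha i))
  rw [← hpq, add_comm, add_mul]
  refine Submodule.add_mem_sup ?_ ?_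
  · refine Submodule.span_induction (p := fun q _ => q * kP c i ∈ _) ?_ ?_ ?_ ?_ hq
    · rintro _ ⟨j, rfl⟩
      rw [mul_comm]
      exact Submodule.subset_span ⟨(i, j), rfl⟩
    · simp
    · intro u v _ _ hu hv
      rw [add_mul]
      exact Submodule.add_mem _ hu hv
    · intro r u _ hu
      rw [smul_mul_assoc]
      exact Submodule.smul_mem _ r hu
  · rw [pow_two]
    exact Ideal.mul_mem_mul hp (kP_mem c i)

lemma finrank_kleinIdeal_sq_le (c : F) :
    Module.finrank F ((kleinIdeal c ^ 2).restrictScalars F ⊓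
      homogeneousSubmodule (Fin 3) F 8 : Submodule F (MvPolynomial (Fin 3) F)) ≤ 36 := by
  let G : Sym2 (Fin 3) → MvPolynomial (Fin 3) F := fun p => (p.map (kP c)).mul
  have hG (p : Sym2 (Fin 3)) : (G p).IsHomogeneous 6 := by
    induction p with
    | _ i j => exact (kP_isHomogeneous c i).mul (kP_isHomogeneous c j)
  have hspan : kleinIdeal c ^ 2 ≤ Ideal.span (Set.range G) := by
    rw [pow_two, kleinIdeal, Ideal.span_mul_span', Ideal.span_le]
    rintro _ ⟨_, ⟨i, rfl⟩, _, ⟨j, rfl⟩, rfl⟩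
    exact Ideal.subset_span ⟨s(i, j), rfl⟩
  let φ : (Sym2 (Fin 3) → homogeneousSubmodule (Fin 3) F 2) →ₗ[F] MvPolynomial (Fin 3) F :=
    ∑ p, (LinearMap.mulRight F (G p)) ∘ₗ (homogeneousSubmodule (Fin 3) F 2).subtype ∘ₗ
      LinearMap.proj p
  have : Module.Finite F (homogeneousSubmodule (Fin 3) F 2) :=
    Module.Finite.iff_fg.2 (homogeneousSubmodule_fg (Fin 3) F 2)
  have hle : (kleinIdeal c ^ 2).restrictScalars F ⊓ homogeneousSubmodule (Fin 3) F 8 ≤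
      LinearMap.range φ := by
    rintro f ⟨hf, hf8⟩
    obtain ⟨a, ha, rfl⟩ := exists_isHomogeneous_eq_sum_mul (e := 2) hG (hspan hf) hf8
    exact ⟨fun p => ⟨a p, ha p⟩, by simp [φ]⟩
  calc _ ≤ Module.finrank F (LinearMap.range φ) := Submodule.finrank_mono hle
    _ ≤ Module.finrank F (Sym2 (Fin 3) → homogeneousSubmodule (Fin 3) F 2) :=
      LinearMap.finrank_range_le φ
    _ = 36 := by
      rw [Module.finrank_pi_fintype]
      simp [finrank_homogeneousSubmodule, Sym2.card, Nat.multichoose_eq, Nat.choose]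

end KleinSyzygies

/-- the space `R₈` of homogeneous octics decomposes as
`span{P_iQ_j : 1 ≤ i,j ≤ 3} ⊕ (P²)₈`, where `P = (P₁,P₂,P₃)`. -/
theorem klein_R8_decomposition {F : Type*} [Field F] (c : F)
    (hc : c ^ 2 + c + 2 = 0) (h2 : ringChar F ≠ 2) (h3 : ringChar F ≠ 3)
    (h7 : ringChar F ≠ 7) :
    let R' := MvPolynomial (Fin 3) F
    let P : Ideal R' := Ideal.span {kP c 0, kP c 1, kP c 2}
    let SPQ : Submodule F R' :=
      Submodule.span F (Set.range fun p : Fin 3 × Fin 3 => kP c p.1 * kQ c p.2)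
    let SP2 : Submodule F R' :=
      (Submodule.restrictScalars F (P ^ 2)) ⊓ homogeneousSubmodule (Fin 3) F 8
    SPQ ⊓ SP2 = ⊥ ∧ SPQ ⊔ SP2 = homogeneousSubmodule (Fin 3) F 8 := by
  intro R' P SPQ SP2
  have h2' : (2 : F) ≠ 0 := Ring.two_ne_zero h2
  have h7' : (7 : F) ≠ 0 := fun h =>
    ((Nat.dvd_prime (by norm_num)).1 (ringChar.dvd (R := F) (x := 7) (by exact_mod_cast h))).elim
      CharP.ringChar_ne_one h7
  have hP : P = kleinIdeal c := by
    have hrange : Set.range (kP c) = {kP c 0, kP c 1, kP c 2} := by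
      ext p
      simp [Fin.exists_fin_succ, eq_comm]
    rw [kleinIdeal, hrange]
  have hPQ : SPQ ≤ homogeneousSubmodule (Fin 3) F 8 := by
    refine Submodule.span_le.2 ?_
    rintro _ ⟨p, rfl⟩
    exact (kP_isHomogeneous c p.1).mul (kQ_isHomogeneous c p.2)
  have hsup : SPQ ⊔ SP2 = homogeneousSubmodule (Fin 3) F 8 := by
    rw [← sup_inf_assoc_of_le _ hPQ, hP]
    exact inf_eq_right.2 (octic_le_sup hc h2' h7')
  refine ⟨?_, hsup⟩
  have : Module.Finite F (homogeneousSubmodule (Fin 3) F 8) :=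
    Module.Finite.iff_fg.2 (homogeneousSubmodule_fg (Fin 3) F 8)
  have : Module.Finite F SPQ := Submodule.finiteDimensional_of_le hPQ
  have : Module.Finite F SP2 := Submodule.finiteDimensional_of_le inf_le_right
  have hrank := Submodule.finrank_sup_add_finrank_inf_eq SPQ SP2
  have hPQ9 : Module.finrank F SPQ ≤ 9 :=
    (finrank_range_le_card fun p : Fin 3 × Fin 3 => kP c p.1 * kQ c p.2).trans (by simp)
  have hP36 : Module.finrank F SP2 ≤ 36 := by
    have h := finrank_kleinIdeal_sq_le c
    rwa [← hP] at h
  have h45 : Module.finrank F (homogeneousSubmodule (Fin 3) F 8) = 45 := by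
    simp [finrank_homogeneousSubmodule, Nat.multichoose_eq, Nat.choose]
  rw [hsup, h45] at hrank
  exact Submodule.finrank_eq_zero.1 (by omega)

end
end

section
/- Let F be a field and let c ∈ F satisfy c^2 + c + 2 = 0; set c̄ = −1 − c (the other root). Then each of the six points (1, c̄^2, 1), (c̄^2, 1, 1), (c^2, 1, 0), (1, c^2, 0), (1, c̄^4, 1), (c̄^4, 1, 1) of F^3 lies on the conic defined by the quadratic form 4x^2 + 4y^2 + (3c+9)xy + (5c−1)xz + (5c−1)yz + (15c+25)z^2, i.e., substituting the coordinates of each point for (x, y, z) in this form yields 0. -/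
/-- the six "squared" Klein points lie on the conic
`4x² + 4y² + (3c+9)xy + (5c−1)xz + (5c−1)yz + (15c+25)z²`. -/
theorem klein_six_points_on_conic {F : Type*} [Field F] (c : F)
    (hc : c ^ 2 + c + 2 = 0) :
    let cbar : F := -1 - c
    let q : F → F → F → F := fun x y z =>
      4 * x ^ 2 + 4 * y ^ 2 + (3 * c + 9) * (x * y) + (5 * c - 1) * (x * z) +
        (5 * c - 1) * (y * z) + (15 * c + 25) * z ^ 2
    q 1 (cbar ^ 2) 1 = 0 ∧ q (cbar ^ 2) 1 1 = 0 ∧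
      q (c ^ 2) 1 0 = 0 ∧ q 1 (c ^ 2) 0 = 0 ∧
      q 1 (cbar ^ 4) 1 = 0 ∧ q (cbar ^ 4) 1 1 = 0 := by
  intro cbar q
  have hc2 : c ^ 2 = -c - 2 := by linear_combination hc
  have hcbar2 : cbar ^ 2 = c - 1 := by linear_combination hc
  have hcbar4 : cbar ^ 4 = -3 * c - 1 := by
    linear_combination (cbar ^ 2 + c - 1) * hcbar2 + hc
  simp only [q, hc2, hcbar2, hcbar4]
  refine ⟨?_, ?_, ?_, ?_, ?_, ?_⟩
  · linear_combination 12 * hc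
  · linear_combination 12 * hc
  · linear_combination hc
  · linear_combination hc
  · linear_combination 12 * hc
  · linear_combination 12 * hc
end
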